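/- arXiv:1303.6618 — 3 statements merged into one kernel-verified Lean document; each statement's English description precedes it below -/
import Mathlib

section
/- With the notation below, let (φ_1,…,φ_𝒩) be an orthonormal basis of ℝ^𝒩, let N ≤ 𝒩, let {𝒫_1,…,𝒫_K} be a measurable partition of 𝒫 with k(μ) denoting the unique index k with μ ∈ 𝒫_k, and let β_{i,k}^{min}, β_{i,k}^{max} be reals with β_{i,k}^{min} ≤ ⟨w(μ'), φ_i⟩ ≤ β_{i,k}^{max} for all μ' ∈ 𝒫_k, all 1 ≤ i ≤ N and 1 ≤ k ≤ K. Define β_i^{up}(μ) = β_{i,k(μ)}^{max} if ⟨r(μ),φ_i⟩ > 0 and β_{i,k(μ)}^{min} otherwise; β_i^{low}(μ) = β_{i,k(μ)}^{min} if ⟨r(μ),φ_i⟩ > 0 and β_{i,k(μ)}^{max} otherwise; T₁^{low}(μ) = Σ_{i=1}^N ⟨r(μ),φ_i⟩ β_i^{low}(μ); T₁^{up}(μ) = Σ_{i=1}^N ⟨r(μ),φ_i⟩ β_i^{up}(μ); T₁(μ) = max(|T₁^{low}(μ)|, |T₁^{up}(μ)|); and T₂ = E_μ[ |Σ_{i=N+1}^{𝒩}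 ⟨w(μ),φ_i⟩⟨r(μ),φ_i⟩| ], assumed finite, where μ is a random variable with values in 𝒫 and all the maps of μ appearing are measurable. Then for every α ∈ (0,1), P( |s(μ) − s̃(μ)| > T₁(μ) + T₂/α ) ≤ α. -/
open Matrix MeasureTheory

/-- The output error is minus the residual weighted by the adjoint solution. -/
theorem dotProduct_sub_eq_neg_adjoint_dotProduct_residual {m : Type*} [Fintype m] [DecidableEq m]
    {A : Matrix m m ℝ} (hA : IsUnit A) (l f v : m → ℝ) :
    l ⬝ᵥ (A⁻¹ *ᵥ f) - l ⬝ᵥ v = -(((Aᵀ)⁻¹ *ᵥ l) ⬝ᵥ (A *ᵥ v - f)) := by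
  have hdet : IsUnit A.det := (Matrix.isUnit_iff_isUnit_det A).mp hA
  have hinv : A⁻¹ *ᵥ (A *ᵥ v) = v := by
    rw [mulVec_mulVec, nonsing_inv_mul A hdet, one_mulVec]
  rw [← transpose_nonsing_inv, mulVec_transpose, ← dotProduct_mulVec, mulVec_sub, hinv,
    dotProduct_sub, neg_sub]

/-- Parseval's identity for coordinate vectors. -/
theorem dotProduct_eq_sum_of_orthonormal {m : Type*} [Fintype m] [DecidableEq m]
    {φ : m → m → ℝ} (hφ : ∀ i j, φ i ⬝ᵥ φ j = if i = j then (1 : ℝ) else 0) (x y : m → ℝ) :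
    x ⬝ᵥ y = ∑ i, (x ⬝ᵥ φ i) * (y ⬝ᵥ φ i) := by
  have hmul : Matrix.of φ * (Matrix.of φ)ᵀ = 1 := by
    ext i j
    simpa [Matrix.mul_apply, Matrix.one_apply, dotProduct] using hφ i j
  have hmul' : (Matrix.of φ)ᵀ * Matrix.of φ = 1 := mul_eq_one_comm.mp hmul
  have hsum : ∑ i, (x ⬝ᵥ φ i) * (y ⬝ᵥ φ i) = (Matrix.of φ *ᵥ x) ⬝ᵥ (Matrix.of φ *ᵥ y) := by
    simp only [dotProduct_comm x, dotProduct_comm y]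
    rfl
  rw [hsum, dotProduct_mulVec, ← mulVec_transpose, mulVec_mulVec, hmul', one_mulVec]

/-- A sum of products is bounded in absolute value by the extreme choices of the second factors. -/
theorem abs_sum_mul_le_max_abs {ι : Type*} (S : Finset ι) (a c lo hi : ι → ℝ)
    (h : ∀ i ∈ S, lo i ≤ c i ∧ c i ≤ hi i) :
    |∑ i ∈ S, c i * a i| ≤
      max |∑ i ∈ S, a i * (if 0 < a i then lo i else hi i)|
        |∑ i ∈ S, a i * (if 0 < a i then hi i else lo i)| := by
  apply abs_le_max_abs_abs
  · refine Finset.sum_le_sum fun i hi => ?_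
    have := h i hi
    split_ifs <;> nlinarith
  · refine Finset.sum_le_sum fun i hi => ?_
    have := h i hi
    split_ifs <;> nlinarith

/-- Markov's inequality for the strict superlevel set at height `E[X] / α`; no positivity of the
expectation is needed. -/
theorem measure_integral_div_lt_le {Ω : Type*} [MeasurableSpace Ω] {P : Measure Ω}
    [IsFiniteMeasure P] {X : Ω → ℝ} (hX : 0 ≤ X) (hint : Integrable X P) {α : ℝ} (hα : 0 < α) :
    P {ω | (∫ ω, X ω ∂P) / α < X ω} ≤ ENNReal.ofReal α := by
  have h0 : 0 ≤ ∫ ω, X ω ∂P := integral_nonneg hX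
  rcases h0.eq_or_lt with hz | hpos
  · have hae : X =ᵐ[P] 0 := (integral_eq_zero_iff_of_nonneg hX hint).mp hz.symm
    have hnull : P {ω | (∫ ω, X ω ∂P) / α < X ω} = 0 := by
      rw [← hz, zero_div]
      refine measure_mono_null (fun ω hω => ?_) (ae_iff.mp hae)
      exact ne_of_gt hω
    simp [hnull]
  · have hmarkov := mul_meas_ge_le_integral_of_nonneg (ae_of_all P hX) hint ((∫ ω, X ω ∂P) / α)
    have hreal : P.real {ω | (∫ ω, X ω ∂P) / α ≤ X ω} ≤ α := by
      rw [div_mul_eq_mul_div, div_le_iff₀ hα] at hmarkov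
      exact le_of_mul_le_mul_left hmarkov hpos
    calc P {ω | (∫ ω, X ω ∂P) / α < X ω}
        ≤ P {ω | (∫ ω, X ω ∂P) / α ≤ X ω} := measure_mono (Set.ofPred_subset_ofPred.mpr fun ω hω => hω.le)
      _ = ENNReal.ofReal (P.real {ω | (∫ ω, X ω ∂P) / α ≤ X ω}) := by simp
      _ ≤ ENNReal.ofReal α := ENNReal.ofReal_le_ofReal hreal

/-- the goal-oriented probabilistic output error bound
P( |s(μ) − s̃(μ)| > T₁(μ) + T₂/α ) ≤ α for every risk level α ∈ (0,1). -/
theorem stmt_4 {𝒩 n K N : ℕ} (hN1 : 1 ≤ 𝒩) (hNN : N ≤ 𝒩) (hK : 1 ≤ K)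
    {Pa : Type*} [MeasurableSpace Pa]
    {Ω : Type*} [MeasureSpace Ω] [IsProbabilityMeasure (volume : Measure Ω)]
    (μv : Ω → Pa) (hμv : Measurable μv)
    (A : Pa → Matrix (Fin 𝒩) (Fin 𝒩) ℝ) (f : Pa → (Fin 𝒩 → ℝ))
    (l : Fin 𝒩 → ℝ) (Z : Matrix (Fin 𝒩) (Fin n) ℝ)
    (hA : ∀ p, IsUnit (A p)) (hAZ : ∀ p, IsUnit (Zᵀ * A p * Z))
    (u : Pa → (Fin 𝒩 → ℝ)) (ut : Pa → (Fin n → ℝ))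
    (w r : Pa → (Fin 𝒩 → ℝ)) (s st : Pa → ℝ)
    (hu : ∀ p, u p = (A p)⁻¹ *ᵥ f p)
    (hut : ∀ p, (Zᵀ * A p * Z) *ᵥ ut p = Zᵀ *ᵥ f p)
    (hw : ∀ p, w p = ((A p)ᵀ)⁻¹ *ᵥ l)
    (hr : ∀ p, r p = A p *ᵥ (Z *ᵥ ut p) - f p)
    (hs : ∀ p, s p = l ⬝ᵥ u p)
    (hst : ∀ p, st p = l ⬝ᵥ (Z *ᵥ ut p))
    -- orthonormal basis of ℝ^𝒩
    (φ : Fin 𝒩 → (Fin 𝒩 → ℝ))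
    (hφ : ∀ i j, φ i ⬝ᵥ φ j = if i = j then (1 : ℝ) else 0)
    -- measurable partition of the parameter set
    (Pk : Fin K → Set Pa) (hPmeas : ∀ k, MeasurableSet (Pk k))
    (hPcov : ∀ p, ∃ k, p ∈ Pk k)
    (hPdisj : ∀ k k', k ≠ k' → Disjoint (Pk k) (Pk k'))
    (kof : Pa → Fin K) (hkof : ∀ p, p ∈ Pk (kof p))
    -- bracketing bounds on ⟨w(μ'), φ_i⟩ on each cell of the partition
    (βmin βmax : Fin 𝒩 → Fin K → ℝ)
    (hβ : ∀ i : Fin 𝒩, (i : ℕ) < N → ∀ k, ∀ p ∈ Pk k,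
      βmin i k ≤ w p ⬝ᵥ φ i ∧ w p ⬝ᵥ φ i ≤ βmax i k)
    -- the computable first-order term T₁
    (T₁ : Pa → ℝ)
    (hT₁ : ∀ p, T₁ p =
      max |∑ i ∈ Finset.univ.filter (fun i : Fin 𝒩 => (i : ℕ) < N),
             (r p ⬝ᵥ φ i) *
               (if 0 < r p ⬝ᵥ φ i then βmin i (kof p) else βmax i (kof p))|
          |∑ i ∈ Finset.univ.filter (fun i : Fin 𝒩 => (i : ℕ) < N),
             (r p ⬝ᵥ φ i) *
               (if 0 < r p ⬝ᵥ φ i then βmax i (kof p) else βmin i (kof p))|)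
    -- the mean absolute tail term T₂, assumed finite
    (T₂ : ℝ)
    (hT₂ : T₂ = ∫ ω, |∑ i ∈ Finset.univ.filter (fun i : Fin 𝒩 => N ≤ (i : ℕ)),
        (w (μv ω) ⬝ᵥ φ i) * (r (μv ω) ⬝ᵥ φ i)|)
    (hInt : Integrable (fun ω =>
        |∑ i ∈ Finset.univ.filter (fun i : Fin 𝒩 => N ≤ (i : ℕ)),
          (w (μv ω) ⬝ᵥ φ i) * (r (μv ω) ⬝ᵥ φ i)|))
    -- measurability of the maps of μ appearing in the statement
    (hmeas1 : Measurable (fun ω => T₁ (μv ω)))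
    (hmeas2 : Measurable (fun ω => s (μv ω) - st (μv ω)))
    (α : ℝ) (hα : 0 < α) (hα1 : α < 1) :
    volume {ω | T₁ (μv ω) + T₂ / α < |s (μv ω) - st (μv ω)|} ≤ ENNReal.ofReal α := by
  have herr : ∀ p, |s p - st p| ≤ T₁ p + |∑ i ∈ Finset.univ.filter
      (fun i : Fin 𝒩 => N ≤ (i : ℕ)), (w p ⬝ᵥ φ i) * (r p ⬝ᵥ φ i)| := by
    intro p
    have hsplit := Finset.sum_filter_add_sum_filter_not Finset.univ
      (fun i : Fin 𝒩 => (i : ℕ) < N) (fun i => (w p ⬝ᵥ φ i) * (r p ⬝ᵥ φ i))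
    simp only [not_lt] at hsplit
    have hst_eq : s p - st p = -(w p ⬝ᵥ r p) := by
      rw [hs, hst, hu, hw, hr]
      exact dotProduct_sub_eq_neg_adjoint_dotProduct_residual (hA p) _ _ _
    rw [hst_eq, abs_neg, dotProduct_eq_sum_of_orthonormal hφ, ← hsplit, hT₁]
    refine (abs_add_le _ _).trans (add_le_add_left ?_ _)
    exact abs_sum_mul_le_max_abs _ (fun i => r p ⬝ᵥ φ i) (fun i => w p ⬝ᵥ φ i)
      (fun i => βmin i (kof p)) (fun i => βmax i (kof p))
      fun i hi => hβ i (Finset.mem_filter.mp hi).2 (kof p) p (hkof p)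
  refine le_trans (measure_mono fun ω hω => ?_)
    (measure_integral_div_lt_le (fun ω => abs_nonneg _) hInt hα)
  rw [Set.mem_ofPred_eq] at hω ⊢
  rw [← hT₂]
  linarith [herr (μv ω)]
end

section
/- With the notation below, for every parameter μ such that A(μ), ZᵀA(μ)Z and Z_dᵀA(μ)ᵀZ_d are invertible, the corrected reduced-output error satisfies the exact representation s̃_c(μ) − s(μ) = ⟨w(μ) − Z_d ũ_d(μ), r(μ)⟩ = −⟨r_d(μ), A(μ)⁻¹ r(μ)⟩. -/
open Matrix

theorem Matrix.transpose_mulVec_dotProduct {m n R : Type*} [Fintype m] [Fintype n]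
    [CommSemiring R] (B : Matrix m n R) (x : m → R) (y : n → R) :
    (Bᵀ *ᵥ x) ⬝ᵥ y = x ⬝ᵥ (B *ᵥ y) := by
  rw [mulVec_transpose, dotProduct_mulVec]

/-- For every parameter μ such that A(μ), ZᵀA(μ)Z and Z_dᵀA(μ)ᵀZ_d are
invertible, the corrected reduced-output error satisfies
s̃_c(μ) − s(μ) = ⟨w(μ) − Z_d ũ_d(μ), r(μ)⟩ = −⟨r_d(μ), A(μ)⁻¹ r(μ)⟩. -/
theorem stmt_5 {𝒩 n nd : ℕ} (hN : 1 ≤ 𝒩) {Pa : Type*}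
    (A : Pa → Matrix (Fin 𝒩) (Fin 𝒩) ℝ) (f : Pa → (Fin 𝒩 → ℝ))
    (l : Fin 𝒩 → ℝ) (Z : Matrix (Fin 𝒩) (Fin n) ℝ)
    (Zd : Matrix (Fin 𝒩) (Fin nd) ℝ)
    (u : Pa → (Fin 𝒩 → ℝ)) (ut : Pa → (Fin n → ℝ)) (utd : Pa → (Fin nd → ℝ))
    (w r rd : Pa → (Fin 𝒩 → ℝ)) (s st stc : Pa → ℝ)
    (hu : ∀ μ, u μ = (A μ)⁻¹ *ᵥ f μ)
    (hut : ∀ μ, (Zᵀ * A μ * Z) *ᵥ ut μ = Zᵀ *ᵥ f μ)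
    (hutd : ∀ μ, (Zdᵀ * (A μ)ᵀ * Zd) *ᵥ utd μ = Zdᵀ *ᵥ l)
    (hw : ∀ μ, w μ = ((A μ)ᵀ)⁻¹ *ᵥ l)
    (hr : ∀ μ, r μ = A μ *ᵥ (Z *ᵥ ut μ) - f μ)
    (hrd : ∀ μ, rd μ = (A μ)ᵀ *ᵥ (Zd *ᵥ utd μ) - l)
    (hs : ∀ μ, s μ = l ⬝ᵥ u μ)
    (hst : ∀ μ, st μ = l ⬝ᵥ (Z *ᵥ ut μ))
    (hstc : ∀ μ, stc μ = st μ - (Zd *ᵥ utd μ) ⬝ᵥ r μ) :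
    ∀ μ, IsUnit (A μ) → IsUnit (Zᵀ * A μ * Z) → IsUnit (Zdᵀ * (A μ)ᵀ * Zd) →
      stc μ - s μ = (w μ - Zd *ᵥ utd μ) ⬝ᵥ r μ ∧
      stc μ - s μ = -(rd μ ⬝ᵥ ((A μ)⁻¹ *ᵥ r μ)) := by
  intro μ hA _ _
  have hdet : IsUnit (A μ).det := (isUnit_iff_isUnit_det _).mp hA
  have hres : (A μ)⁻¹ *ᵥ r μ = Z *ᵥ ut μ - u μ := by
    rw [hr, hu, mulVec_sub, mulVec_mulVec, nonsing_inv_mul _ hdet, one_mulVec]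
  have hadj : w μ ⬝ᵥ r μ = l ⬝ᵥ ((A μ)⁻¹ *ᵥ r μ) := by
    rw [hw, ← transpose_nonsing_inv, transpose_mulVec_dotProduct]
  have hdual : ((A μ)ᵀ *ᵥ (Zd *ᵥ utd μ)) ⬝ᵥ ((A μ)⁻¹ *ᵥ r μ) = (Zd *ᵥ utd μ) ⬝ᵥ r μ := by
    rw [transpose_mulVec_dotProduct, mulVec_mulVec, mul_nonsing_inv _ hdet, one_mulVec]
  have herr : l ⬝ᵥ ((A μ)⁻¹ *ᵥ r μ) = st μ - s μ := by
    rw [hres, dotProduct_sub, hst, hs]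
  constructor
  · rw [sub_dotProduct, hadj, herr, hstc]
    ring
  · rw [hrd, sub_dotProduct, hdual, herr, hstc]
    ring
end

section
/- With the notation below, suppose that for a given parameter μ there is α(μ) > 0 such that ⟨v, A(μ) v⟩ ≥ α(μ) ‖v‖² for all v ∈ ℝ^𝒩. Then the corrected reduced output satisfies the dual-based error bound |s(μ) − s̃_c(μ)| ≤ ‖r(μ)‖ ‖r_d(μ)‖ / α(μ). -/
open Matrix

theorem real_dotProduct_self_nonneg {ι : Type*} [Fintype ι] (v : ι → ℝ) : 0 ≤ v ⬝ᵥ v :=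
  Finset.sum_nonneg fun i _ => mul_self_nonneg (v i)

/-- The Cauchy–Schwarz inequality for the real dot product. -/
theorem abs_dotProduct_le_sqrt_mul_sqrt {ι : Type*} [Fintype ι] (v w : ι → ℝ) :
    |v ⬝ᵥ w| ≤ Real.sqrt (v ⬝ᵥ v) * Real.sqrt (w ⬝ᵥ w) := by
  rw [← Real.sqrt_mul (real_dotProduct_self_nonneg v)]
  apply Real.abs_le_sqrt
  simpa only [dotProduct, ← pow_two] using Finset.sum_mul_sq_le_sq_mul_sq Finset.univ v w

/-- Stability estimate for a coercive matrix: `‖e‖ ≤ ‖B e‖ / α`. -/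
theorem sqrt_dotProduct_self_le_of_coercive {ι : Type*} [Fintype ι] {B : Matrix ι ι ℝ} {α : ℝ}
    (hα : 0 < α) (hB : ∀ v : ι → ℝ, α * (v ⬝ᵥ v) ≤ v ⬝ᵥ (B *ᵥ v)) (e : ι → ℝ) :
    Real.sqrt (e ⬝ᵥ e) ≤ Real.sqrt ((B *ᵥ e) ⬝ᵥ (B *ᵥ e)) / α := by
  rw [le_div_iff₀ hα]
  rcases (Real.sqrt_nonneg (e ⬝ᵥ e)).eq_or_lt with h | h
  · rw [← h, zero_mul]
    exact Real.sqrt_nonneg _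
  · refine le_of_mul_le_mul_left ?_ h
    calc Real.sqrt (e ⬝ᵥ e) * (Real.sqrt (e ⬝ᵥ e) * α)
        = α * (e ⬝ᵥ e) := by
          rw [← mul_assoc, Real.mul_self_sqrt (real_dotProduct_self_nonneg e), mul_comm]
      _ ≤ e ⬝ᵥ (B *ᵥ e) := hB e
      _ ≤ _ := (le_abs_self _).trans (abs_dotProduct_le_sqrt_mul_sqrt _ _)

/-- under coercivity ⟨v, A(μ)v⟩ ≥ α(μ)‖v‖², the corrected reduced output
satisfies the dual-based error bound |s(μ) − s̃_c(μ)| ≤ ‖r(μ)‖ ‖r_d(μ)‖ / α(μ). -/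
theorem stmt_6 {𝒩 n nd : ℕ} (hN : 1 ≤ 𝒩)
    (A : Matrix (Fin 𝒩) (Fin 𝒩) ℝ) (f : Fin 𝒩 → ℝ) (l : Fin 𝒩 → ℝ)
    (Z : Matrix (Fin 𝒩) (Fin n) ℝ) (Zd : Matrix (Fin 𝒩) (Fin nd) ℝ)
    (hA : IsUnit A) (hAZ : IsUnit (Zᵀ * A * Z)) (hAZd : IsUnit (Zdᵀ * Aᵀ * Zd))
    (u : Fin 𝒩 → ℝ) (ut : Fin n → ℝ) (utd : Fin nd → ℝ)
    (r rd : Fin 𝒩 → ℝ) (s st stc : ℝ)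
    (hu : u = A⁻¹ *ᵥ f)
    (hut : (Zᵀ * A * Z) *ᵥ ut = Zᵀ *ᵥ f)
    (hutd : (Zdᵀ * Aᵀ * Zd) *ᵥ utd = Zdᵀ *ᵥ l)
    (hr : r = A *ᵥ (Z *ᵥ ut) - f)
    (hrd : rd = Aᵀ *ᵥ (Zd *ᵥ utd) - l)
    (hs : s = l ⬝ᵥ u)
    (hst : st = l ⬝ᵥ (Z *ᵥ ut))
    (hstc : stc = st - (Zd *ᵥ utd) ⬝ᵥ r)
    (αμ : ℝ) (hαμ : 0 < αμ)
    (hcoer : ∀ v : Fin 𝒩 → ℝ, αμ * (v ⬝ᵥ v) ≤ v ⬝ᵥ (A *ᵥ v)) :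
    |s - stc| ≤ Real.sqrt (r ⬝ᵥ r) * Real.sqrt (rd ⬝ᵥ rd) / αμ := by
  have hAu : A *ᵥ u = f := by
    rw [hu, mulVec_mulVec, mul_nonsing_inv _ ((isUnit_iff_isUnit_det A).mp hA), one_mulVec]
  have hAe : A *ᵥ (Z *ᵥ ut - u) = r := by rw [mulVec_sub, hAu, hr]
  have herr : s - stc = rd ⬝ᵥ (Z *ᵥ ut - u) := by
    rw [hrd, sub_dotProduct, mulVec_transpose, ← dotProduct_mulVec, hAe, dotProduct_sub,
      hstc, hst, hs]
    ring
  calc |s - stc|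
      ≤ Real.sqrt (rd ⬝ᵥ rd) * Real.sqrt ((Z *ᵥ ut - u) ⬝ᵥ (Z *ᵥ ut - u)) :=
        herr ▸ abs_dotProduct_le_sqrt_mul_sqrt _ _
    _ ≤ Real.sqrt (rd ⬝ᵥ rd) * (Real.sqrt (r ⬝ᵥ r) / αμ) := by
        gcongr
        exact hAe ▸ sqrt_dotProduct_self_le_of_coercive hαμ hcoer (Z *ᵥ ut - u)
    _ = _ := by ring
end
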